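/- Let Q be a set of X-labeled graphs. If H ∈ mpcs_{+t}(Q) and H' ∈ ext_{+1}(H), then H' ∈ mpcs_{+(t+1)}(Q). -/

import Mathlib

namespace FDel

open scoped Classical

noncomputable section

/-- A boundaried `X`-labeled graph on the vertex universe `ℕ`: a (finite) vertex set,
a symmetric loopless adjacency relation, a labelset for each vertex, and a partial
assignment of boundary indices to vertices. -/
structure BLG (X : Type) where
  verts : Set ℕ
  Adj : ℕ → ℕ → Prop
  label : ℕ → Set X
  bnd : ℕ → Option ℕ

variable {X : Type}

/-- Well-formedness of `G` as a `t`-boundaried `X`-labeled graph: the vertex set is finite,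
adjacency is symmetric, loopless and supported on the vertex set, labels and boundary
indices live on vertices, the boundary assignment is injective, and indices lie in `{1,…,t}`. -/
def BLG.WF (t : ℕ) (G : BLG X) : Prop :=
  G.verts.Finite ∧
  (∀ u v, G.Adj u v → G.Adj v u) ∧
  (∀ v, ¬ G.Adj v v) ∧
  (∀ u v, G.Adj u v → u ∈ G.verts ∧ v ∈ G.verts) ∧
  (∀ v, v ∉ G.verts → G.label v = ∅ ∧ G.bnd v = none) ∧
  (∀ u v i, G.bnd u = some i → G.bnd v = some i → u = v) ∧
  (∀ v i, G.bnd v = some i → v ∈ G.verts ∧ 1 ≤ i ∧ i ≤ t)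

/-- Reachability inside the vertex set `S`. -/
def ReachIn (G : BLG X) (S : Set ℕ) (a b : ℕ) : Prop :=
  Relation.ReflTransGen (fun u v => G.Adj u v ∧ u ∈ S ∧ v ∈ S) a b

/-- `C` is (the vertex set of) a connected component of the subgraph of `G` induced by `S`. -/
def IsCompOf (G : BLG X) (S C : Set ℕ) : Prop :=
  ∃ v ∈ S, C = {w | w ∈ S ∧ ReachIn G S v w}

/-- `G` is connected (and nonempty). -/
def BLG.Conn (G : BLG X) : Prop :=
  G.verts.Nonempty ∧ ∀ a ∈ G.verts, ∀ b ∈ G.verts, ReachIn G G.verts a b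

/-- Isomorphism of boundaried labeled graphs: a bijection of the vertex sets preserving
adjacency, labelsets and boundary indices. -/
def Iso (G G' : BLG X) : Prop :=
  ∃ f : ℕ → ℕ, Set.BijOn f G.verts G'.verts ∧
    (∀ u ∈ G.verts, ∀ v ∈ G.verts, (G.Adj u v ↔ G'.Adj (f u) (f v))) ∧
    (∀ v ∈ G.verts, G'.label (f v) = G.label v) ∧
    (∀ v ∈ G.verts, G'.bnd (f v) = G.bnd v)

/-- A boundaried labeled minor model of `H` in `G`. -/
structure MinorModel (H G : BLG X) (φ : ℕ → Set ℕ) : Prop where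
  sub : ∀ v ∈ H.verts, φ v ⊆ G.verts
  nonempty : ∀ v ∈ H.verts, (φ v).Nonempty
  conn : ∀ v ∈ H.verts, ∀ a ∈ φ v, ∀ b ∈ φ v, ReachIn G (φ v) a b
  disj : ∀ u ∈ H.verts, ∀ v ∈ H.verts, u ≠ v → Disjoint (φ u) (φ v)
  edge : ∀ u ∈ H.verts, ∀ v ∈ H.verts, H.Adj u v → ∃ a ∈ φ u, ∃ b ∈ φ v, G.Adj a b
  bnd_none : ∀ v ∈ H.verts, H.bnd v = none → ∀ a ∈ φ v, G.bnd a = none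
  bnd_some : ∀ v ∈ H.verts, ∀ i, H.bnd v = some i →
    (∀ a ∈ φ v, G.bnd a = none ∨ G.bnd a = some i) ∧ ∃ a ∈ φ v, G.bnd a = some i
  labels : ∀ v ∈ H.verts, ∀ x, x ∈ H.label v → ∃ a ∈ φ v, x ∈ G.label a

/-- `H` is a boundaried labeled minor of `G`. -/
def Minor (H G : BLG X) : Prop := ∃ φ, MinorModel H G φ

/-- Auxiliary injection for the right summand of `⊕`: a vertex of `G2` that is a boundary
vertex whose index also occurs in `G1` is identified with the corresponding vertex of `G1`. -/
def rmap (G1 G2 : BLG X) (v : ℕ) : ℕ :=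
  if h : ∃ u, u ∈ G1.verts ∧ ∃ i, G2.bnd v = some i ∧ G1.bnd u = some i
  then 2 * Classical.choose h
  else 2 * v + 1

/-- The sum `G1 ⊕ G2`: disjoint union with boundary vertices of equal index identified. -/
def glue (G1 G2 : BLG X) : BLG X where
  verts := (fun v => 2 * v) '' G1.verts ∪ rmap G1 G2 '' G2.verts
  Adj a b :=
    (∃ u ∈ G1.verts, ∃ v ∈ G1.verts, G1.Adj u v ∧ a = 2 * u ∧ b = 2 * v) ∨
    (∃ u ∈ G2.verts, ∃ v ∈ G2.verts, G2.Adj u v ∧ a = rmap G1 G2 u ∧ b = rmap G1 G2 v)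
  label x := {l | (∃ v ∈ G1.verts, x = 2 * v ∧ l ∈ G1.label v) ∨
                  (∃ v ∈ G2.verts, x = rmap G1 G2 v ∧ l ∈ G2.label v)}
  bnd x :=
    if x ∈ (fun v => 2 * v) '' G1.verts ∪ rmap G1 G2 '' G2.verts then
      (if x % 2 = 0 then G1.bnd (x / 2) else G2.bnd (x / 2))
    else none

/-- One-vertex piece on vertex `v`, with boundary index `i` and labelset `L`. -/
def singlePc (v i : ℕ) (L : Set X) : BLG X :=
  ⟨{v}, fun _ _ => False, fun x => if x = v then L else ∅,
   fun x => if x = v then some i else none⟩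

/-- Two-vertex piece consisting of the single edge `{u,v}` with boundary indices `i`, `j`. -/
def edgePc (u v i j : ℕ) : BLG X :=
  ⟨{u, v}, fun a b => (a = u ∧ b = v) ∨ (a = v ∧ b = u), fun _ => ∅,
   fun x => if x = u then some i else if x = v then some j else none⟩

/-- The non-boundary vertices of `G`. -/
def interior (G : BLG X) : Set ℕ := {v | v ∈ G.verts ∧ G.bnd v = none}

/-- The piece of `G` corresponding to a connected component `C` of `G − δ(G)`: `C` together
with its neighboring boundary vertices, with edges between boundary vertices removed and all
labels removed from boundary vertices. -/
def compPc (G : BLG X) (C : Set ℕ) : BLG X :=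
  ⟨C ∪ {v | v ∈ G.verts ∧ G.bnd v ≠ none ∧ ∃ c ∈ C, G.Adj v c},
   fun a b => G.Adj a b ∧
     (a ∈ C ∪ {v | v ∈ G.verts ∧ G.bnd v ≠ none ∧ ∃ c ∈ C, G.Adj v c}) ∧
     (b ∈ C ∪ {v | v ∈ G.verts ∧ G.bnd v ≠ none ∧ ∃ c ∈ C, G.Adj v c}) ∧
     ¬(G.bnd a ≠ none ∧ G.bnd b ≠ none),
   fun x => if x ∈ C then G.label x else ∅,
   fun x => if x ∈ C ∪ {v | v ∈ G.verts ∧ G.bnd v ≠ none ∧ ∃ c ∈ C, G.Adj v c}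
            then G.bnd x else none⟩

/-- The set of pieces of `G`. -/
def pcs (G : BLG X) : Set (BLG X) :=
  {p | ∃ v ∈ G.verts, ∃ i, G.bnd v = some i ∧ p = singlePc v i (∅ : Set X)} ∪
  {p | ∃ v ∈ G.verts, ∃ i, G.bnd v = some i ∧ ∃ l ∈ G.label v, p = singlePc v i {l}} ∪
  {p | ∃ u v i j, G.Adj u v ∧ G.bnd u = some i ∧ G.bnd v = some j ∧ p = edgePc u v i j} ∪
  {p | ∃ C, IsCompOf G (interior G) C ∧ p = compPc G C}

/-- The sum `⊕_{p ∈ P} p` of a set of pieces of a common graph; since pieces of a common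
graph overlap exactly in boundary vertices (with equal indices), the sum is the union. -/
def unionOf (P : Set (BLG X)) : BLG X :=
  ⟨⋃ p ∈ P, p.verts,
   fun a b => ∃ p ∈ P, p.Adj a b,
   fun x => ⋃ p ∈ P, p.label x,
   fun x => if h : ∃ p, p ∈ P ∧ p.bnd x ≠ none then (Classical.choose h).bnd x else none⟩

/-- `mpcs(G)`: all sums of nonempty subsets of the pieces of `G`, up to isomorphism. -/
def mpcs (G : BLG X) : Set (BLG X) :=
  {H | ∃ P ⊆ pcs G, P.Nonempty ∧ Iso H (unionOf P)}

/-- `mpcs` of a set of graphs. -/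
def mpcsSet (S : Set (BLG X)) : Set (BLG X) := ⋃ G ∈ S, mpcs G

/-- Assign boundary index `i` to the vertex `v` of `G`. -/
def assignBnd (G : BLG X) (v i : ℕ) : BLG X :=
  ⟨G.verts, G.Adj, G.label, Function.update G.bnd v (some i)⟩

/-- Split the boundary vertex `u` of `G`: add a new vertex `w` with boundary index `i` and
the edge `{u,w}`, reattach the edges `{u,b}` with `ME b` to `w`, and move the labels `l` of
`u` with `ML l` to `w`. -/
def splitVx (G : BLG X) (u w i : ℕ) (ME : ℕ → Prop) (ML : X → Prop) : BLG X :=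
  ⟨insert w G.verts,
   fun a b =>
     (a = w ∧ b = u) ∨ (a = u ∧ b = w) ∨
     (a = w ∧ b ≠ w ∧ G.Adj u b ∧ ME b) ∨ (b = w ∧ a ≠ w ∧ G.Adj u a ∧ ME a) ∨
     (a ≠ w ∧ b ≠ w ∧ G.Adj a b ∧ ¬(a = u ∧ ME b) ∧ ¬(b = u ∧ ME a)),
   fun x => if x = w then {l | l ∈ G.label u ∧ ML l}
            else if x = u then {l | l ∈ G.label u ∧ ¬ ML l}
            else G.label x,
   fun x => if x = w then some i else G.bnd x⟩

/-- One extension step turning a `t`-boundaried graph into a `(t+1)`-boundaried one (up to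
isomorphism): keep the graph unchanged, assign index `t+1` to a non-boundary vertex, or
split a boundary vertex. -/
def ExtOne (t : ℕ) (H H' : BLG X) : Prop :=
  Iso H' H ∨
  (∃ v ∈ H.verts, H.bnd v = none ∧ Iso H' (assignBnd H v (t + 1))) ∨
  (∃ u ∈ H.verts, ∃ i, H.bnd u = some i ∧ ∃ w, w ∉ H.verts ∧
    ∃ ME : ℕ → Prop, ∃ ML : X → Prop, Iso H' (splitVx H u w (t + 1) ME ML))

/-- `H' ∈ ext_{+k}(H)` for a `t`-boundaried graph `H`: `k` successive extension steps. -/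
def ExtN (t : ℕ) : ℕ → BLG X → BLG X → Prop
  | 0, H, H' => Iso H' H
  | k + 1, H, H' => ∃ H'', ExtN t k H H'' ∧ ExtOne (t + k) H'' H'

/-- `ext_{+k}` of a set of `t`-boundaried graphs. -/
def extSet (t k : ℕ) (S : Set (BLG X)) : Set (BLG X) := {H' | ∃ H ∈ S, ExtN t k H H'}

/-- `mpcs_{+t}(S)` for a set `S` of unboundaried graphs. -/
def mpcsPlus (t : ℕ) (S : Set (BLG X)) : Set (BLG X) := mpcsSet (extSet 0 t S)

/-- `forget(G,k)`: forget the boundary status of all boundary vertices with index `> k`. -/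
def forget (G : BLG X) (k : ℕ) : BLG X :=
  ⟨G.verts, G.Adj, G.label, fun v => (G.bnd v).bind fun i => if i ≤ k then some i else none⟩

/-- Membership in a set of graphs, up to isomorphism. -/
def MemIso (H : BLG X) (S : Set (BLG X)) : Prop := ∃ H' ∈ S, Iso H H'

/-- `G1` and `G2` share no edge: no edge between boundary indices `i,j` occurs in both. -/
def EdgeDisjoint (G1 G2 : BLG X) : Prop :=
  ¬ ∃ i j, (∃ u v, G1.Adj u v ∧ G1.bnd u = some i ∧ G1.bnd v = some j) ∧
           (∃ u v, G2.Adj u v ∧ G2.bnd u = some i ∧ G2.bnd v = some j)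

/-- The merge `Π1 ⊙_F Π2`. -/
def Merge (F : Set (BLG X)) (t : ℕ) (P1 P2 : Set (BLG X)) : Set (BLG X) :=
  {G | G ∈ mpcsPlus t F ∧ ∀ G1 G2 : BLG X, G1.WF t → G2.WF t → EdgeDisjoint G1 G2 →
    Iso (glue G1 G2) G →
    (∃ H ∈ P1, Minor H G1) ∨ (∃ H ∈ P2, Minor H G2)}

/-- `(P1, P2) ∈ split_F(P)`: both contain `P`; for every `G ∈ P` and every subset `Y` of its
pieces, the sum over `Y` was added to `P1` or the sum over the complement was added to `P2`;
and every member of `P1`/`P2` is accounted for by one of the two addition rules. -/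
def SplitMem (F : Set (BLG X)) (t : ℕ) (P P1 P2 : Set (BLG X)) : Prop :=
  P ⊆ P1 ∧ P ⊆ P2 ∧
  (∀ G ∈ P, ∀ Y ⊆ pcs G, MemIso (unionOf Y) P1 ∨ MemIso (unionOf (pcs G \ Y)) P2) ∧
  (∀ H ∈ P1, H ∈ P ∨ (∃ G ∈ P, ∃ Y ⊆ pcs G, Iso H (unionOf Y)) ∨
    (H ∈ mpcsPlus t F ∧ ∃ H', Minor H' H ∧ MemIso H' P1)) ∧
  (∀ H ∈ P2, H ∈ P ∨ (∃ G ∈ P, ∃ Y ⊆ pcs G, Iso H (unionOf Y)) ∨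
    (H ∈ mpcsPlus t F ∧ ∃ H', Minor H' H ∧ MemIso H' P2))

/-- `folio*_{Q,t}(G)`: the boundaried labeled minors of `G` lying in `mpcs_{+t}(Q)`. -/
def folioStar (Q : Set (BLG X)) (t : ℕ) (G : BLG X) : Set (BLG X) :=
  {H | H ∈ mpcsPlus t Q ∧ Minor H G}

/-- The `(t+1)`-boundaried graphs in which boundary index `t+1` is assigned to a vertex. -/
def defBnd (t : ℕ) : Set (BLG X) := {G | ∃ v ∈ G.verts, G.bnd v = some t}

theorem Iso.trans {G₁ G₂ G₃ : BLG X} (h₁ : Iso G₁ G₂) (h₂ : Iso G₂ G₃) : Iso G₁ G₃ := by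
  obtain ⟨f, hf, fa, fl, fb⟩ := h₁
  obtain ⟨g, hg, ga, gl, gb⟩ := h₂
  refine ⟨g ∘ f, hg.comp hf, fun u hu v hv => ?_, fun v hv => ?_, fun v hv => ?_⟩
  · exact (fa u hu v hv).trans (ga _ (hf.mapsTo hu) _ (hf.mapsTo hv))
  · exact (gl _ (hf.mapsTo hv)).trans (fl v hv)
  · exact (gb _ (hf.mapsTo hv)).trans (fb v hv)

/-- Graphs with the same vertices that agree on them are isomorphic. -/
theorem Iso.of_eqOn {G G' : BLG X} (hv : G.verts = G'.verts)
    (ha : ∀ u ∈ G.verts, ∀ v ∈ G.verts, (G.Adj u v ↔ G'.Adj u v))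
    (hl : ∀ v ∈ G.verts, G'.label v = G.label v)
    (hb : ∀ v ∈ G.verts, G'.bnd v = G.bnd v) : Iso G G' :=
  ⟨id, by rw [← hv]; exact Set.bijOn_id _, ha, hl, hb⟩

theorem ExtOne.of_iso {t : ℕ} {H H' H'' : BLG X} (h : Iso H'' H') (he : ExtOne t H H') :
    ExtOne t H H'' := by
  rcases he with he | ⟨v, hv, hb, he⟩ | ⟨u, hu, i, hi, w, hw, ME, ML, he⟩
  · exact Or.inl (h.trans he)
  · exact Or.inr (Or.inl ⟨v, hv, hb, h.trans he⟩)
  · exact Or.inr (Or.inr ⟨u, hu, i, hi, w, hw, ME, ML, h.trans he⟩)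

theorem ExtN.of_iso {t k : ℕ} {H H' H'' : BLG X} (h : Iso H'' H') (he : ExtN t k H H') :
    ExtN t k H H'' := by
  cases k with
  | zero => exact Iso.trans h he
  | succ k =>
    obtain ⟨K, hK, he⟩ := he
    exact ⟨K, hK, he.of_iso h⟩

theorem Iso.assignBnd {H U : BLG X} {f : ℕ → ℕ} (hf : Set.BijOn f H.verts U.verts)
    (fa : ∀ u ∈ H.verts, ∀ v ∈ H.verts, (H.Adj u v ↔ U.Adj (f u) (f v)))
    (fl : ∀ v ∈ H.verts, U.label (f v) = H.label v)
    (fb : ∀ v ∈ H.verts, U.bnd (f v) = H.bnd v) {v : ℕ} (hv : v ∈ H.verts) (i : ℕ) :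
    Iso (assignBnd H v i) (assignBnd U (f v) i) := by
  refine ⟨f, hf, fa, fl, fun x hx => ?_⟩
  by_cases hxv : x = v
  · subst hxv; simp [FDel.assignBnd]
  · have : f x ≠ f v := fun h => hxv (hf.injOn hx hv h)
    simp only [FDel.assignBnd, Function.update_of_ne this, Function.update_of_ne hxv]
    exact fb x hx

theorem Iso.splitVx {H U : BLG X} {f : ℕ → ℕ} (hf : Set.BijOn f H.verts U.verts)
    (fa : ∀ u ∈ H.verts, ∀ v ∈ H.verts, (H.Adj u v ↔ U.Adj (f u) (f v)))
    (fl : ∀ v ∈ H.verts, U.label (f v) = H.label v)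
    (fb : ∀ v ∈ H.verts, U.bnd (f v) = H.bnd v) {u w w' : ℕ} (hu : u ∈ H.verts)
    (hw : w ∉ H.verts) (hw' : w' ∉ U.verts) (i : ℕ) (ME : ℕ → Prop) (ML : X → Prop) :
    Iso (splitVx H u w i ME ML)
      (splitVx U (f u) w' i (fun b => ∃ a ∈ H.verts, f a = b ∧ ME a) ML) := by
  set g : ℕ → ℕ := Function.update f w w' with hg
  have gw : g w = w' := by simp [hg]
  have ne : ∀ {x}, x ∈ H.verts → x ≠ w := fun hx h => hw (h ▸ hx)
  have gx : ∀ {x}, x ∈ H.verts → g x = f x := fun hx => by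
    simp [hg, Function.update_of_ne (ne hx)]
  have fne : ∀ {x}, x ∈ H.verts → f x ≠ w' := fun hx h => hw' (h ▸ hf.mapsTo hx)
  have fme : ∀ {x}, x ∈ H.verts → ((∃ a ∈ H.verts, f a = f x ∧ ME a) ↔ ME x) := by
    intro x hx
    constructor
    · rintro ⟨a, ha, h, hm⟩
      rwa [← hf.injOn ha hx h]
    · exact fun h => ⟨x, hx, rfl, h⟩
  have feq : ∀ {x y}, x ∈ H.verts → y ∈ H.verts → (f x = f y ↔ x = y) :=
    fun hx hy => hf.injOn.eq_iff hx hy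
  refine ⟨g, ⟨?_, ?_, ?_⟩, ?_, ?_, ?_⟩
  · rintro x (rfl | hx)
    · exact Or.inl gw
    · rw [gx hx]; exact Or.inr (hf.mapsTo hx)
  · rintro x (rfl | hx) y (rfl | hy) hxy
    · rfl
    · rw [gw, gx hy] at hxy; exact absurd hxy.symm (fne hy)
    · rw [gw, gx hx] at hxy; exact absurd hxy (fne hx)
    · rw [gx hx, gx hy] at hxy; exact hf.injOn hx hy hxy
  · rintro y (rfl | hy)
    · exact ⟨w, Or.inl rfl, gw⟩
    · obtain ⟨x, hx, rfl⟩ := hf.surjOn hy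
      exact ⟨x, Or.inr hx, gx hx⟩
  · rintro a (rfl | ha) b (rfl | hb)
    · rw [gw]
      simp [FDel.splitVx, (ne hu).symm, (fne hu).symm]
    · rw [gw, gx hb]
      simp [FDel.splitVx, ne hb, fne hb, (ne hu).symm, (fne hu).symm, fme hb, feq hb hu,
        fa u hu b hb]
    · rw [gw, gx ha]
      simp [FDel.splitVx, ne ha, fne ha, (ne hu).symm, (fne hu).symm, fme ha, feq ha hu,
        fa u hu a ha]
    · rw [gx ha, gx hb]
      simp only [FDel.splitVx, fme ha, fme hb]
      simp [ne ha, fne ha, ne hb, fne hb, feq ha hu, feq hb hu,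
        fa a ha b hb]
  · rintro x (rfl | hx)
    · rw [gw]; simp [FDel.splitVx, fl u hu]
    · rw [gx hx]; simp [FDel.splitVx, ne hx, fne hx, feq hx hu, fl u hu, fl x hx]
  · rintro x (rfl | hx)
    · rw [gw]; simp [FDel.splitVx]
    · rw [gx hx]; simp [FDel.splitVx, ne hx, fne hx, fb x hx]

/-- Adjacency of `G` is symmetric on the vertices of `G`. -/
def SymmOn (G : BLG X) : Prop := ∀ u ∈ G.verts, ∀ v ∈ G.verts, G.Adj u v → G.Adj v u

theorem SymmOn.of_iso {G G' : BLG X} (h : Iso G G') (hs : SymmOn G') : SymmOn G := by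
  obtain ⟨f, hf, fa, -, -⟩ := h
  intro u hu v hv huv
  exact (fa v hv u hu).2 (hs _ (hf.mapsTo hu) _ (hf.mapsTo hv) ((fa u hu v hv).1 huv))

theorem SymmOn.splitVx {G : BLG X} (hs : SymmOn G) (u w i : ℕ) (ME : ℕ → Prop)
    (ML : X → Prop) : SymmOn (splitVx G u w i ME ML) := by
  rintro a ha b hb hab
  have ha' : a = w ∨ a ∈ G.verts := ha
  have hb' : b = w ∨ b ∈ G.verts := hb
  simp only [FDel.splitVx] at hab ⊢
  rcases hab with h | h | h | h | ⟨haw, hbw, h, h₁, h₂⟩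
  · tauto
  · tauto
  · tauto
  · tauto
  · have := hs a (ha'.resolve_left haw) b (hb'.resolve_left hbw) h
    tauto

theorem SymmOn.extOne {t : ℕ} {H H' : BLG X} (hs : SymmOn H) (he : ExtOne t H H') :
    SymmOn H' := by
  rcases he with he | ⟨v, hv, hb, he⟩ | ⟨u, hu, i, hi, w, hw, ME, ML, he⟩
  · exact hs.of_iso he
  · exact SymmOn.of_iso he hs
  · exact (hs.splitVx u w _ ME ML).of_iso he

theorem SymmOn.extN {t k : ℕ} {H H' : BLG X} (hs : SymmOn H) (he : ExtN t k H H') :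
    SymmOn H' := by
  induction k generalizing H' with
  | zero => exact hs.of_iso he
  | succ k ih =>
    obtain ⟨K, hK, he⟩ := he
    exact (ih hK).extOne he

/-- `U` is a sum of pieces of a graph that agrees with `G` on the vertices of `G`. Since
isomorphisms ignore everything outside the vertex set, such a graph may have arbitrary edge
pieces with an end outside `G.verts`. -/
structure IsPart (G U : BLG X) : Prop where
  nonempty : U.verts.Nonempty
  bnd_eq : ∀ v ∈ U.verts, v ∈ G.verts → U.bnd v = G.bnd v
  outer_bnd : ∀ v ∈ U.verts, v ∉ G.verts → U.bnd v ≠ none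
  outer_label : ∀ v ∈ U.verts, v ∉ G.verts → U.label v = ∅
  outer_edge : ∀ v ∈ U.verts, v ∉ G.verts → ∃ b, U.Adj v b
  adj_mem : ∀ a b, U.Adj a b → a ∈ U.verts
  adj_symm : ∀ a b, U.Adj a b → U.Adj b a
  int_label : ∀ c ∈ U.verts, U.bnd c = none → U.label c = G.label c
  int_adj : ∀ c ∈ U.verts, U.bnd c = none → ∀ b, U.Adj c b ↔ b ∈ G.verts ∧ G.Adj c b
  label_sub : ∀ v ∈ U.verts, v ∈ G.verts → U.label v ⊆ G.label v
  adj_sub : ∀ a ∈ G.verts, ∀ b ∈ G.verts, U.Adj a b → G.Adj a b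

theorem IsPart.assignBnd {G U : BLG X} (h : IsPart G U) {v : ℕ} (i : ℕ) :
    IsPart (assignBnd G v i) (assignBnd U v i) := by
  have key : ∀ c, (FDel.assignBnd U v i).bnd c = none → U.bnd c = none := by
    intro c hc
    simp only [FDel.assignBnd, Function.update_apply] at hc
    split_ifs at hc
    exact hc
  exact
  { nonempty := h.nonempty
    bnd_eq := fun x hx hxG => by
      simp only [FDel.assignBnd, Function.update_apply, h.bnd_eq x hx hxG]
    outer_bnd := fun x hx hxG hn => h.outer_bnd x hx hxG (key x hn)
    outer_label := h.outer_label
    outer_edge := h.outer_edge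
    adj_mem := h.adj_mem
    adj_symm := h.adj_symm
    int_label := fun c hc hn => h.int_label c hc (key c hn)
    int_adj := fun c hc hn => h.int_adj c hc (key c hn)
    label_sub := h.label_sub
    adj_sub := h.adj_sub }

theorem IsPart.splitVx {G U : BLG X} (hs : SymmOn G) (h : IsPart G U) {u w : ℕ} (i : ℕ)
    (ME : ℕ → Prop) (ML : X → Prop) (huU : u ∈ U.verts) (hu : U.bnd u ≠ none)
    (hwU : w ∉ U.verts) (hwG : w ∉ G.verts) (huG : u ∈ G.verts) :
    IsPart (splitVx G u w i ME ML) (splitVx U u w i ME ML) := by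
  obtain ⟨h1, h2, h3, h4, h5, h6, h7, h8, h9, h10, h11⟩ := h
  have hint : ∀ c ∈ U.verts, U.bnd c = none → c ∈ G.verts := fun c hc hn => by
    by_contra hcG; exact h3 c hc hcG hn
  refine ⟨⟨u, Or.inr huU⟩, ?_, ?_, ?_, ?_, ?_, ?_, ?_, ?_, ?_, ?_⟩
  all_goals simp only [FDel.splitVx, Set.mem_insert_iff]
  · grind
  · grind
  · grind
  · intro v hv hvG
    push Not at hvG
    obtain ⟨b, hb⟩ := h5 v (hv.resolve_left hvG.1) hvG.2
    by_cases hbu : b = u ∧ ME v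
    · exact ⟨w, by have := h7 v b hb; grind⟩
    · exact ⟨b, by have := h6 b v (h7 v b hb); grind⟩
  · grind
  · grind
  · grind
  · intro c hc hn b
    have hcw : c ≠ w := by grind
    have hcU := hc.resolve_left hcw
    have hn' : U.bnd c = none := by grind
    have hcu : c ≠ u := by grind
    have hcG := hint c hcU hn'
    have e : ∀ b, U.Adj c b ↔ b ∈ G.verts ∧ G.Adj c b := h9 c hcU hn'
    have e' : U.Adj u c ↔ G.Adj u c :=
      ⟨fun k => h11 u huG c hcG k, fun k => h7 _ _ ((e u).2 ⟨huG, hs u huG c hcG k⟩)⟩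
    have := e b
    by_cases hbw : b = w
    · subst hbw
      simp [hcw, hcu, e']
    · simp [hcw, hcu, hbw, e b]
      tauto
  · intro v hv hvG
    split_ifs with hvw hvu
    · exact fun l hl => ⟨h10 u huU huG hl.1, hl.2⟩
    · exact fun l hl => ⟨h10 u huU huG hl.1, hl.2⟩
    · exact h10 v (hv.resolve_left hvw) (hvG.resolve_left hvw)
  · intro a ha b hb hab
    rcases hab with h | h | ⟨haw, hbw, h, hm⟩ | ⟨hbw, haw, h, hm⟩ | ⟨haw, hbw, h, hm₁, hm₂⟩
    · exact Or.inl h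
    · exact Or.inr (Or.inl h)
    · exact Or.inr (Or.inr (Or.inl ⟨haw, hbw, h11 u huG b (hb.resolve_left hbw) h, hm⟩))
    · have := h11 u huG a (ha.resolve_left haw) h
      exact Or.inr (Or.inr (Or.inr (Or.inl ⟨hbw, haw, this, hm⟩)))
    · have := h11 a (ha.resolve_left haw) b (hb.resolve_left hbw) h
      exact Or.inr (Or.inr (Or.inr (Or.inr ⟨haw, hbw, this, hm₁, hm₂⟩)))

theorem IsPart.splitVx_of_notMem {G U : BLG X} (h : IsPart G U) {u w : ℕ} (i : ℕ)
    (ME : ℕ → Prop) (ML : X → Prop) (huU : u ∈ U.verts)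
    (hwU : w ∉ U.verts) (hwG : w ∉ G.verts) (huG : u ∉ G.verts) :
    IsPart G (FDel.splitVx U u w i ME ML) := by
  obtain ⟨h1, h2, h3, h4, h5, h6, h7, h8, h9, h10, h11⟩ := h
  have hu := h3 u huU huG
  have hlu := h4 u huU huG
  refine ⟨⟨u, Or.inr huU⟩, ?_, ?_, ?_, ?_, ?_, ?_, ?_, ?_, ?_, ?_⟩
  all_goals simp only [FDel.splitVx, Set.mem_insert_iff]
  · grind
  · grind
  · grind
  · intro v hv hvG
    by_cases hvw : v = w
    · exact ⟨u, Or.inl ⟨hvw, rfl⟩⟩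
    obtain ⟨b, hb⟩ := h5 v (hv.resolve_left hvw) hvG
    by_cases hvu : v = u
    · exact ⟨w, Or.inr (Or.inl ⟨hvu, rfl⟩)⟩
    by_cases hbu : b = u ∧ ME v
    · exact ⟨w, by have := h7 v b hb; grind⟩
    · exact ⟨b, by have := h6 b v (h7 v b hb); grind⟩
  · grind
  · grind
  · grind
  · intro c hc hn b
    have hcw : c ≠ w := by grind
    have hcU := hc.resolve_left hcw
    have hn' : U.bnd c = none := by grind
    have hcu : c ≠ u := by grind
    have e : ∀ b, U.Adj c b ↔ b ∈ G.verts ∧ G.Adj c b := h9 c hcU hn'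
    have e' : ¬ U.Adj u c := fun k => huG ((e u).1 (h7 _ _ k)).1
    by_cases hbw : b = w
    · subst hbw
      simp [hcw, hcu, e', hwG]
    · simp [hcw, hcu, hbw, e b]
      grind
  · grind
  · grind

/-- The graph `G` with its vertices shifted by one, so that `0` is not a vertex. -/
def shift (G : BLG X) : BLG X :=
  ⟨{x | x ≠ 0 ∧ x - 1 ∈ G.verts}, fun a b => a ≠ 0 ∧ b ≠ 0 ∧ G.Adj (a - 1) (b - 1),
    fun x => G.label (x - 1), fun x => G.bnd (x - 1)⟩

theorem shift_iso (G : BLG X) : Iso (shift G) G := by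
  refine ⟨fun x => x - 1, ⟨fun x hx => hx.2, fun x hx y hy hxy => ?_, fun y hy =>
    ⟨y + 1, ⟨by simp, by simpa using hy⟩, by simp⟩⟩, fun u hu v hv => ?_,
    fun _ _ => rfl, fun _ _ => rfl⟩
  · have := hx.1; have := hy.1; dsimp at hxy; omega
  · simp [shift, hu.1, hv.1]

theorem iso_shift (G : BLG X) : Iso G (shift G) := by
  refine ⟨fun x => x + 1, ⟨fun x hx => ⟨by simp, by simpa using hx⟩, fun x hx y hy hxy => ?_,
    fun y hy => ⟨y - 1, hy.2, ?_⟩⟩, fun u hu v hv => ?_,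
    fun _ _ => by simp [shift], fun _ _ => by simp [shift]⟩
  · simpa using hxy
  · have := hy.1; dsimp; omega
  · simp [shift]

theorem IsPart.shift {G U : BLG X} (h : IsPart G U) : IsPart (shift G) (shift U) := by
  obtain ⟨h1, h2, h3, h4, h5, h6, h7, h8, h9, h10, h11⟩ := h
  refine ⟨?_, ?_, ?_, ?_, ?_, ?_, ?_, ?_, ?_, ?_, ?_⟩
  all_goals simp only [FDel.shift, Set.mem_ofPred_eq]
  · obtain ⟨x, hx⟩ := h1
    exact ⟨x + 1, by simp, by simpa using hx⟩
  · grind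
  · grind
  · grind
  · rintro v ⟨hv0, hv⟩ hvG
    obtain ⟨b, hb⟩ := h5 (v - 1) hv (fun k => hvG ⟨hv0, k⟩)
    exact ⟨b + 1, hv0, by simp, by simpa using hb⟩
  · grind
  · grind
  · grind
  · rintro c ⟨hc0, hc⟩ hn b
    have := h9 _ hc hn (b - 1)
    tauto
  · grind
  · grind

/-- The boundary indices of a piece of `G` are those of `G`. -/
theorem bnd_eq_of_mem_pcs {G p : BLG X} (hp : p ∈ pcs G) {x : ℕ} (hx : x ∈ p.verts) :
    p.bnd x = G.bnd x := by
  rcases hp with ((⟨v, hv, i, hi, rfl⟩ | ⟨v, hv, i, hi, l, hl, rfl⟩) |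
    ⟨u, v, i, j, ha, hi, hj, rfl⟩) | ⟨C, hC, rfl⟩
  · simp only [singlePc, Set.mem_singleton_iff] at hx ⊢
    simp [hx, hi]
  · simp only [singlePc, Set.mem_singleton_iff] at hx ⊢
    simp [hx, hi]
  · simp only [edgePc, Set.mem_insert_iff, Set.mem_singleton_iff] at hx ⊢
    grind
  · exact if_pos hx

theorem mem_verts_of_bnd_ne_none {G p : BLG X} (hp : p ∈ pcs G) {x : ℕ}
    (hx : p.bnd x ≠ none) : x ∈ p.verts := by
  rcases hp with ((⟨v, hv, i, hi, rfl⟩ | ⟨v, hv, i, hi, l, hl, rfl⟩) |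
    ⟨u, v, i, j, ha, hi, hj, rfl⟩) | ⟨C, hC, rfl⟩
  · by_contra h; exact hx (if_neg h)
  · by_contra h; exact hx (if_neg h)
  · by_contra h
    simp only [edgePc, Set.mem_insert_iff, Set.mem_singleton_iff] at hx h
    grind
  · by_contra h; exact hx (if_neg h)

theorem unionOf_bnd {G : BLG X} {P : Set (BLG X)} (hP : P ⊆ pcs G) {x : ℕ}
    (hx : x ∈ (unionOf P).verts) : (unionOf P).bnd x = G.bnd x := by
  simp only [unionOf, Set.mem_iUnion, exists_prop] at hx ⊢
  obtain ⟨p, hp, hxp⟩ := hx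
  split_ifs with h
  · have hc := Classical.choose_spec h
    exact bnd_eq_of_mem_pcs (hP hc.1) (mem_verts_of_bnd_ne_none (hP hc.1) hc.2)
  · by_contra hne
    exact h ⟨p, hp, by rw [bnd_eq_of_mem_pcs (hP hp) hxp]; exact fun k => hne k.symm⟩

theorem IsCompOf.subset {G : BLG X} {S C : Set ℕ} (h : IsCompOf G S C) : C ⊆ S := by
  obtain ⟨v, -, rfl⟩ := h
  exact fun x hx => hx.1

theorem IsCompOf.closed {G : BLG X} {S C : Set ℕ} (h : IsCompOf G S C) {c b : ℕ}
    (hc : c ∈ C) (hb : b ∈ S) (hcb : G.Adj c b) : b ∈ C := by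
  obtain ⟨v, -, rfl⟩ := h
  exact ⟨hb, hc.2.tail ⟨hcb, hc.1, hb⟩⟩

/-- Every piece that is not a component piece consists of boundary vertices. -/
theorem exists_compPc_of_mem_interior {G p : BLG X} (hp : p ∈ pcs G) {c : ℕ}
    (hc : c ∈ p.verts) (hn : G.bnd c = none) :
    ∃ C, IsCompOf G (interior G) C ∧ p = compPc G C ∧ c ∈ C := by
  rcases hp with ((⟨v, hv, i, hi, rfl⟩ | ⟨v, hv, i, hi, l, hl, rfl⟩) |
    ⟨u, v, i, j, ha, hi, hj, rfl⟩) | ⟨C, hC, rfl⟩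
  · simp only [singlePc, Set.mem_singleton_iff] at hc; grind
  · simp only [singlePc, Set.mem_singleton_iff] at hc; grind
  · simp only [edgePc, Set.mem_insert_iff, Set.mem_singleton_iff] at hc; grind
  · refine ⟨C, hC, rfl, ?_⟩
    rcases hc with hc | hc
    · exact hc
    · exact absurd hn hc.2.1

/-- A piece with a vertex outside `G.verts` is an edge piece. -/
theorem exists_edgePc_of_notMem {G p : BLG X} (hp : p ∈ pcs G) {x : ℕ}
    (hx : x ∈ p.verts) (hxG : x ∉ G.verts) :
    ∃ u v i j, G.Adj u v ∧ G.bnd u = some i ∧ G.bnd v = some j ∧ p = edgePc u v i j := by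
  rcases hp with ((⟨v, hv, i, hi, rfl⟩ | ⟨v, hv, i, hi, l, hl, rfl⟩) | hp) | ⟨C, hC, rfl⟩
  · exact absurd (Set.mem_singleton_iff.1 hx ▸ hv) hxG
  · exact absurd (Set.mem_singleton_iff.1 hx ▸ hv) hxG
  · exact hp
  · rcases hx with hx | hx
    · exact absurd (hC.subset hx).1 hxG
    · exact absurd hx.1 hxG

theorem label_of_mem_pcs {G p : BLG X} (hp : p ∈ pcs G) {x : ℕ} {l : X}
    (hl : l ∈ p.label x) : x ∈ G.verts ∧ l ∈ G.label x := by
  rcases hp with ((⟨v, hv, i, hi, rfl⟩ | ⟨v, hv, i, hi, l', hl', rfl⟩) |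
    ⟨u, v, i, j, ha, hi, hj, rfl⟩) | ⟨C, hC, rfl⟩
  · simp [singlePc] at hl
  · simp only [singlePc] at hl
    split_ifs at hl with h
    · rw [Set.mem_singleton_iff] at hl
      subst h hl
      exact ⟨hv, hl'⟩
    · exact absurd hl (Set.notMem_empty l)
  · exact absurd hl (Set.notMem_empty l)
  · simp only [compPc] at hl
    split_ifs at hl with h
    · exact ⟨(hC.subset h).1, hl⟩
    · exact absurd hl (Set.notMem_empty l)

theorem adj_mem_of_mem_pcs {G p : BLG X} (hp : p ∈ pcs G) {a b : ℕ} (h : p.Adj a b) :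
    a ∈ p.verts := by
  rcases hp with ((⟨v, hv, i, hi, rfl⟩ | ⟨v, hv, i, hi, l', hl', rfl⟩) |
    ⟨u, v, i, j, ha, hi, hj, rfl⟩) | ⟨C, hC, rfl⟩
  · exact h.elim
  · exact h.elim
  · simp only [edgePc, Set.mem_insert_iff, Set.mem_singleton_iff] at h ⊢
    tauto
  · exact h.2.1

theorem compPc_verts_subset {G : BLG X} {C : Set ℕ} (hC : IsCompOf G (interior G) C) :
    (compPc G C).verts ⊆ G.verts := by
  rintro x (hx | hx)
  · exact (hC.subset hx).1
  · exact hx.1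

theorem adj_symm_of_mem_pcs {G p : BLG X} (hs : SymmOn G) (hp : p ∈ pcs G) {a b : ℕ}
    (h : p.Adj a b) : p.Adj b a := by
  rcases hp with ((⟨v, hv, i, hi, rfl⟩ | ⟨v, hv, i, hi, l', hl', rfl⟩) |
    ⟨u, v, i, j, ha, hi, hj, rfl⟩) | ⟨C, hC, rfl⟩
  · exact h.elim
  · exact h.elim
  · simp only [edgePc] at h ⊢
    tauto
  · obtain ⟨h1, h2, h3, h4⟩ := h
    exact ⟨hs a (compPc_verts_subset hC h2) b (compPc_verts_subset hC h3) h1, h3, h2,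
      fun k => h4 k.symm⟩

theorem adj_of_mem_pcs {G p : BLG X} (hs : SymmOn G) (hp : p ∈ pcs G) {a b : ℕ}
    (ha : a ∈ G.verts) (hb : b ∈ G.verts) (h : p.Adj a b) : G.Adj a b := by
  rcases hp with ((⟨v, hv, i, hi, rfl⟩ | ⟨v, hv, i, hi, l', hl', rfl⟩) |
    ⟨u, v, i, j, huv, hi, hj, rfl⟩) | ⟨C, hC, rfl⟩
  · exact h.elim
  · exact h.elim
  · rcases h with ⟨rfl, rfl⟩ | ⟨rfl, rfl⟩
    · exact huv
    · exact hs b hb a ha huv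
  · exact h.1

theorem compPc_adj {G : BLG X} (hs : SymmOn G) {C : Set ℕ}
    (hC : IsCompOf G (interior G) C) {c b : ℕ} (hc : c ∈ C) (hb : b ∈ G.verts)
    (h : G.Adj c b) : (compPc G C).Adj c b := by
  have hci := hC.subset hc
  refine ⟨h, Or.inl hc, ?_, fun k => k.1 hci.2⟩
  by_cases hbn : G.bnd b = none
  · exact Or.inl (hC.closed hc ⟨hb, hbn⟩ h)
  · exact Or.inr ⟨hb, hbn, c, hc, hs c hci.1 b hb h⟩

theorem verts_nonempty_of_mem_pcs {G p : BLG X} (hp : p ∈ pcs G) : p.verts.Nonempty := by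
  rcases hp with ((⟨v, hv, i, hi, rfl⟩ | ⟨v, hv, i, hi, l', hl', rfl⟩) |
    ⟨u, v, i, j, huv, hi, hj, rfl⟩) | ⟨C, ⟨v, hv, rfl⟩, rfl⟩
  · exact ⟨v, rfl⟩
  · exact ⟨v, rfl⟩
  · exact ⟨u, Or.inl rfl⟩
  · exact ⟨v, Or.inl ⟨hv, Relation.ReflTransGen.refl⟩⟩

theorem isPart_unionOf {G : BLG X} (hs : SymmOn G) {P : Set (BLG X)} (hP : P ⊆ pcs G)
    (hne : P.Nonempty) : IsPart G (unionOf P) := by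
  have mem : ∀ {x}, x ∈ (unionOf P).verts ↔ ∃ p ∈ P, x ∈ p.verts := by
    intro x; simp [unionOf]
  have meml : ∀ {x l}, l ∈ (unionOf P).label x ↔ ∃ p ∈ P, l ∈ p.label x := by
    intro x l; simp [unionOf]
  have outer : ∀ v ∈ (unionOf P).verts, v ∉ G.verts →
      ∃ p ∈ P, ∃ a b i j, G.bnd a = some i ∧ G.bnd b = some j ∧ p = edgePc a b i j ∧
        (v = a ∨ v = b) := by
    intro v hv hvG
    obtain ⟨p, hp, hvp⟩ := mem.1 hv
    obtain ⟨a, b, i, j, -, hi, hj, rfl⟩ := exists_edgePc_of_notMem (hP hp) hvp hvG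
    exact ⟨_, hp, a, b, i, j, hi, hj, rfl, hvp⟩
  refine ⟨?_, fun v hv _ => unionOf_bnd hP hv, ?_, ?_, ?_, ?_, ?_, ?_, ?_, ?_, ?_⟩
  · obtain ⟨p, hp⟩ := hne
    obtain ⟨x, hx⟩ := verts_nonempty_of_mem_pcs (hP hp)
    exact ⟨x, mem.2 ⟨p, hp, hx⟩⟩
  · intro v hv hvG
    rw [unionOf_bnd hP hv]
    obtain ⟨p, hp, a, b, i, j, hi, hj, -, rfl | rfl⟩ := outer v hv hvG <;> simp [*]
  · intro v hv hvG
    refine Set.eq_empty_of_forall_notMem fun l hl => ?_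
    obtain ⟨p, hp, hlp⟩ := meml.1 hl
    exact hvG (label_of_mem_pcs (hP hp) hlp).1
  · intro v hv hvG
    obtain ⟨p, hp, a, b, i, j, hi, hj, rfl, rfl | rfl⟩ := outer v hv hvG
    · exact ⟨b, _, hp, Or.inl ⟨rfl, rfl⟩⟩
    · exact ⟨a, _, hp, Or.inr ⟨rfl, rfl⟩⟩
  · rintro a b ⟨p, hp, h⟩
    exact mem.2 ⟨p, hp, adj_mem_of_mem_pcs (hP hp) h⟩
  · rintro a b ⟨p, hp, h⟩
    exact ⟨p, hp, adj_symm_of_mem_pcs hs (hP hp) h⟩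
  · intro c hc hn
    rw [unionOf_bnd hP hc] at hn
    refine Set.Subset.antisymm (fun l hl => ?_) fun l hl => ?_
    · obtain ⟨p, hp, hlp⟩ := meml.1 hl
      exact (label_of_mem_pcs (hP hp) hlp).2
    · obtain ⟨p, hp, hcp⟩ := mem.1 hc
      obtain ⟨C, hC, rfl, hcC⟩ := exists_compPc_of_mem_interior (hP hp) hcp hn
      exact meml.2 ⟨_, hp, by simpa [compPc, hcC] using hl⟩
  · intro c hc hn b
    rw [unionOf_bnd hP hc] at hn
    constructor
    · rintro ⟨p, hp, h⟩
      obtain ⟨C, hC, rfl, hcC⟩ :=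
        exists_compPc_of_mem_interior (hP hp) (adj_mem_of_mem_pcs (hP hp) h) hn
      exact ⟨compPc_verts_subset hC h.2.2.1, h.1⟩
    · rintro ⟨hb, h⟩
      obtain ⟨p, hp, hcp⟩ := mem.1 hc
      obtain ⟨C, hC, rfl, hcC⟩ := exists_compPc_of_mem_interior (hP hp) hcp hn
      exact ⟨_, hp, compPc_adj hs hC hcC hb h⟩
  · intro v _ _ l hl
    obtain ⟨p, hp, hlp⟩ := meml.1 hl
    exact (label_of_mem_pcs (hP hp) hlp).2
  · rintro a ha b hb ⟨p, hp, h⟩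
    exact adj_of_mem_pcs hs (hP hp) ha hb h

/-- `G` with its adjacency and boundary indices outside `G.verts` taken from `U`. -/
def override (G U : BLG X) : BLG X :=
  ⟨G.verts, fun a b => if a ∈ G.verts ∧ b ∈ G.verts then G.Adj a b else U.Adj a b, G.label,
    fun v => if v ∈ G.verts then G.bnd v else U.bnd v⟩

theorem override_iso (G U : BLG X) : Iso (override G U) G := by
  refine Iso.of_eqOn rfl (fun u hu v hv => ?_) (fun _ _ => rfl) fun v hv => ?_
  · exact iff_of_eq (if_pos ⟨hu, hv⟩)
  · exact (if_pos hv).symm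

theorem IsPart.override_mpcs {G U : BLG X} (hs : SymmOn G) (h : IsPart G U) :
    U ∈ mpcs (override G U) := by
  set K := override G U with hK
  have hsK : SymmOn K := hs.of_iso (override_iso G U)
  have hbK : ∀ v ∈ U.verts, K.bnd v = U.bnd v := by
    intro v hv
    by_cases hvG : v ∈ G.verts
    · exact (if_pos hvG).trans (h.bnd_eq v hv hvG).symm
    · exact if_neg hvG
  have haK : ∀ a b, U.Adj a b → K.Adj a b := by
    intro a b hab
    by_cases hG : a ∈ G.verts ∧ b ∈ G.verts
    · exact (iff_of_eq (if_pos hG)).2 (h.adj_sub a hG.1 b hG.2 hab)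
    · exact (iff_of_eq (if_neg hG)).2 hab
  have hint : ∀ c ∈ U.verts, U.bnd c = none → c ∈ K.verts := by
    intro c hc hn
    by_contra hcG
    exact h.outer_bnd c hc hcG hn
  have hintK : ∀ c ∈ U.verts, U.bnd c = none → ∀ b ∈ K.verts, K.Adj c b → U.Adj c b := by
    intro c hc hn b hb hcb
    exact (h.int_adj c hc hn b).2 ⟨hb, (iff_of_eq (if_pos ⟨hint c hc hn, hb⟩)).1 hcb⟩
  have adj_mem' : ∀ a b, U.Adj a b → b ∈ U.verts :=
    fun a b hab => h.adj_mem b a (h.adj_symm a b hab)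
  set P : Set (BLG X) := {p | p ∈ pcs K ∧ p.verts ⊆ U.verts ∧
    (∀ a b, p.Adj a b → U.Adj a b) ∧ ∀ x, p.label x ⊆ U.label x}
  have hP : P ⊆ pcs K := fun p hp => hp.1
  have hcomp : ∀ c ∈ U.verts, U.bnd c = none → ∃ C, IsCompOf K (interior K) C ∧ c ∈ C ∧
      compPc K C ∈ P := by
    intro c hc hn
    have hci : c ∈ interior K := ⟨hint c hc hn, (hbK c hc).trans hn⟩
    set C : Set ℕ := {x | x ∈ interior K ∧ ReachIn K (interior K) c x}
    have hC : IsCompOf K (interior K) C := ⟨c, hci, rfl⟩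
    have hCU : ∀ x ∈ C, x ∈ U.verts := by
      rintro x ⟨-, hx⟩
      induction hx with
      | refl => exact hc
      | tail _ hyz ih =>
        exact adj_mem' _ _ (hintK _ ih (by rw [← hbK _ ih]; exact hyz.2.1.2) _ hyz.2.2.1 hyz.1)
    have hCn : ∀ x ∈ C, U.bnd x = none := fun x hx => by
      rw [← hbK x (hCU x hx)]; exact hx.1.2
    have hCadj : ∀ x ∈ C, ∀ b ∈ K.verts, K.Adj x b → U.Adj x b :=
      fun x hx => hintK x (hCU x hx) (hCn x hx)
    refine ⟨C, hC, ⟨hci, Relation.ReflTransGen.refl⟩, Or.inr ⟨C, hC, rfl⟩, ?_, ?_, ?_⟩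
    · rintro x (hx | ⟨hxK, hxb, d, hd, hxd⟩)
      · exact hCU x hx
      · exact adj_mem' d x (hCadj d hd x hxK (hsK x hxK d hd.1.1 hxd))
    · rintro a b ⟨hab, ha, hb, hnb⟩
      have haK' := compPc_verts_subset hC ha
      have hbK' := compPc_verts_subset hC hb
      rcases ha with ha | ha
      · exact hCadj a ha b hbK' hab
      · rcases hb with hb | hb
        · exact h.adj_symm _ _ (hCadj b hb a haK' (hsK a haK' b hbK' hab))
        · exact absurd ⟨ha.2.1, hb.2.1⟩ hnb
    · intro x l hl
      simp only [compPc] at hl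
      split_ifs at hl with hx
      · rw [h.int_label x (hCU x hx) (hCn x hx)]; exact hl
      · exact absurd hl (Set.notMem_empty l)
  have hedge : ∀ a b i j, U.Adj a b → U.bnd a = some i → U.bnd b = some j →
      edgePc a b i j ∈ P := by
    intro a b i j hab hi hj
    refine ⟨Or.inl (Or.inr ⟨a, b, i, j, haK a b hab, ?_, ?_, rfl⟩), ?_, ?_, ?_⟩
    · rw [hbK a (h.adj_mem a b hab), hi]
    · rw [hbK b (adj_mem' a b hab), hj]
    · rintro x (rfl | rfl)
      · exact h.adj_mem x b hab
      · exact adj_mem' a x hab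
    · rintro x y (⟨rfl, rfl⟩ | ⟨rfl, rfl⟩)
      · exact hab
      · exact h.adj_symm _ _ hab
    · exact fun x => Set.empty_subset _
  have hadj : ∀ a b, U.Adj a b → ∃ p ∈ P, p.Adj a b := by
    intro a b hab
    have ha := h.adj_mem a b hab
    have hb := adj_mem' a b hab
    have comp : ∀ c d, U.Adj c d → U.bnd c = none → ∃ p ∈ P, p.Adj c d := by
      intro c d hcd hn
      have hc := h.adj_mem c d hcd
      obtain ⟨C, hC, hcC, hCP⟩ := hcomp c hc hn
      exact ⟨_, hCP, compPc_adj hsK hC hcC ((h.int_adj c hc hn d).1 hcd).1 (haK c d hcd)⟩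
    cases hi : U.bnd a with
    | none => exact comp a b hab hi
    | some i =>
      cases hj : U.bnd b with
      | none =>
        obtain ⟨p, hp, hpa⟩ := comp b a (h.adj_symm a b hab) hj
        exact ⟨p, hp, adj_symm_of_mem_pcs hsK (hP hp) hpa⟩
      | some j => exact ⟨_, hedge a b i j hab hi hj, Or.inl ⟨rfl, rfl⟩⟩
  have hsingle : ∀ v ∈ U.verts, v ∈ G.verts → ∀ i, U.bnd v = some i →
      singlePc v i (∅ : Set X) ∈ P := by
    intro v hv hvG i hi
    refine ⟨Or.inl (Or.inl (Or.inl ⟨v, hvG, i, (hbK v hv).trans hi, rfl⟩)), ?_,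
      fun _ _ k => k.elim, fun x => by simp [singlePc]⟩
    rintro x rfl
    exact hv
  have hverts : ∀ v ∈ U.verts, ∃ p ∈ P, v ∈ p.verts := by
    intro v hv
    by_cases hvG : v ∈ G.verts
    · cases hi : U.bnd v with
      | none =>
        obtain ⟨C, hC, hcC, hCP⟩ := hcomp v hv hi
        exact ⟨_, hCP, Or.inl hcC⟩
      | some i => exact ⟨_, hsingle v hv hvG i hi, rfl⟩
    · obtain ⟨b, hb⟩ := h.outer_edge v hv hvG
      obtain ⟨p, hp, hpa⟩ := hadj v b hb
      exact ⟨p, hp, adj_mem_of_mem_pcs (hP hp) hpa⟩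
  have hlabel : ∀ v ∈ U.verts, ∀ l ∈ U.label v, ∃ p ∈ P, l ∈ p.label v := by
    intro v hv l hl
    by_cases hvG : v ∈ G.verts
    · cases hi : U.bnd v with
      | none =>
        obtain ⟨C, hC, hcC, hCP⟩ := hcomp v hv hi
        refine ⟨_, hCP, ?_⟩
        rw [h.int_label v hv hi] at hl
        exact (congrArg (l ∈ ·) (if_pos hcC)).mpr hl
      | some i =>
        refine ⟨singlePc v i {l}, ⟨Or.inl (Or.inl (Or.inr ⟨v, hvG, i, (hbK v hv).trans hi, l,
          h.label_sub v hv hvG hl, rfl⟩)), ?_, fun _ _ k => k.elim, fun x => ?_⟩, ?_⟩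
        · rintro x rfl
          exact hv
        · simp only [singlePc]
          split_ifs with hx
          · subst hx; simpa using hl
          · exact Set.empty_subset _
        · simp [singlePc]
    · rw [h.outer_label v hv hvG] at hl
      exact absurd hl (Set.notMem_empty l)
  have hUv : U.verts = (unionOf P).verts := by
    ext x
    simp only [unionOf, Set.mem_iUnion, exists_prop]
    exact ⟨hverts x, fun ⟨p, hp, hx⟩ => hp.2.1 hx⟩
  refine ⟨P, hP, ?_, Iso.of_eqOn hUv ?_ ?_ ?_⟩
  · obtain ⟨v, hv⟩ := h.nonempty
    obtain ⟨p, hp, -⟩ := hverts v hv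
    exact ⟨p, hp⟩
  · exact fun a _ b _ => ⟨hadj a b, fun ⟨p, hp, hab⟩ => hp.2.2.1 a b hab⟩
  · intro v hv
    ext l
    simp only [unionOf, Set.mem_iUnion, exists_prop]
    exact ⟨fun ⟨p, hp, hl⟩ => hp.2.2.2 v hl, hlabel v hv l⟩
  · intro v hv
    rw [unionOf_bnd hP (hUv ▸ hv), hbK v hv]

theorem mem_mpcsPlus_succ_of_isPart {t : ℕ} {Q : Set (BLG X)} {q K G U H : BLG X}
    (hq : q ∈ Q) (hK : ExtN 0 t q K) (hG : ExtOne t K G) (hs : SymmOn G) (h : IsPart G U)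
    (hH : Iso H U) : H ∈ mpcsPlus (t + 1) Q := by
  obtain ⟨P, hP, hne, hU⟩ := h.override_mpcs hs
  refine Set.mem_biUnion (x := override G U) ⟨q, hq, K, hK, ?_⟩ ⟨P, hP, hne, hH.trans hU⟩
  rw [Nat.zero_add]
  exact hG.of_iso (override_iso G U)

/-- For a set `Q` of (unboundaried) `X`-labeled graphs: if
`H ∈ mpcs_{+t}(Q)` and `H' ∈ ext_{+1}(H)`, then `H' ∈ mpcs_{+(t+1)}(Q)`. -/
theorem stmt10 {X : Type} (t : ℕ) (Q : Set (BLG X)) (hQ : ∀ q ∈ Q, q.WF 0)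
    (H H' : BLG X) (hH : H ∈ mpcsPlus t Q) (hH' : ExtOne t H H') :
    H' ∈ mpcsPlus (t + 1) Q := by
  obtain ⟨K, ⟨q, hq, hK⟩, P, hP, hne, hHP⟩ := Set.mem_iUnion₂.1 hH
  have hsK : SymmOn K := SymmOn.extN (fun u _ v _ => (hQ q hq).2.1 u v) hK
  set G := shift K with hG
  set U := shift (unionOf P) with hU
  have hsG : SymmOn G := hsK.of_iso (shift_iso K)
  have hqG : ExtN 0 t q G := hK.of_iso (shift_iso K)
  have hpart : IsPart G U := (isPart_unionOf hsK hP hne).shift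
  have hrefl : ∀ K : BLG X, Iso K K := fun K =>
    Iso.of_eqOn rfl (fun _ _ _ _ => Iff.rfl) (fun _ _ => rfl) fun _ _ => rfl
  have hHU : Iso H U := hHP.trans (iso_shift _)
  obtain ⟨f, hf, fa, fl, fb⟩ := id hHU
  have h0G : 0 ∉ G.verts := fun h => h.1 rfl
  have h0U : 0 ∉ U.verts := fun h => h.1 rfl
  rcases hH' with he | ⟨v, hv, hb, he⟩ | ⟨u, hu, i, hi, w, hw, ME, ML, he⟩
  · exact mem_mpcsPlus_succ_of_isPart hq hqG (Or.inl (hrefl G)) hsG hpart (he.trans hHU)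
  · have hvU := hf.mapsTo hv
    have hbU : U.bnd (f v) = none := (fb v hv).trans hb
    have hvG : f v ∈ G.verts := by
      by_contra hvG
      exact hpart.outer_bnd _ hvU hvG hbU
    exact mem_mpcsPlus_succ_of_isPart hq hqG
      (Or.inr (Or.inl ⟨f v, hvG, (hpart.bnd_eq _ hvU hvG).symm.trans hbU, hrefl _⟩)) hsG
      (hpart.assignBnd (t + 1)) (he.trans (Iso.assignBnd hf fa fl fb hv (t + 1)))
  · have huU := hf.mapsTo hu
    have hbU : U.bnd (f u) = some i := (fb u hu).trans hi
    have hsplit := he.trans (Iso.splitVx hf fa fl fb hu hw h0U (t + 1) ME ML)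
    by_cases huG : f u ∈ G.verts
    · exact mem_mpcsPlus_succ_of_isPart hq hqG
        (Or.inr (Or.inr ⟨f u, huG, i, (hpart.bnd_eq _ huU huG).symm.trans hbU, 0, h0G, _, ML,
          hrefl _⟩)) (hsG.splitVx _ _ _ _ _)
        (hpart.splitVx hsG (t + 1) _ ML huU (by simp [hbU]) h0U h0G huG) hsplit
    · exact mem_mpcsPlus_succ_of_isPart hq hqG (Or.inl (hrefl G)) hsG
        (hpart.splitVx_of_notMem (t + 1) _ ML huU h0U h0G huG) hsplit

end

end FDel
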